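/- arXiv:2206.14954 — 15 statements merged into one kernel-verified Lean document; each statement's English description precedes it below -/
import Mathlib

section
/- Let k1, k2, k3, k4 be integers with k1*k4 - k2*k3 = 1 and |k1 + k4| > 2. Then the set of pairs (s, p) of nonzero complex numbers such that either (s^{k1} * p^{k3} = s and s^{k2} * p^{k4} = p) or (s^{k1} * p^{k3} = s^{-1} and s^{k2} * p^{k4} = p^{-1}) is finite. -/
/-- In a field, there are finitely many `n`-th roots of unity for `n ≠ 0`. -/
theorem finite_setOf_zpow_eq_one {K : Type*} [Field K] {n : ℤ} (hn : n ≠ 0) :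
    {z : K | z ^ n = 1}.Finite := by
  have hpos : 0 < n.natAbs := Int.natAbs_pos.mpr hn
  refine (Multiset.finite_toSet (Polynomial.nthRoots n.natAbs (1 : K))).subset fun z hz => ?_
  change z ∈ Polynomial.nthRoots n.natAbs (1 : K)
  rw [Polynomial.mem_nthRoots hpos]
  replace hz : z ^ n = 1 := hz
  rcases Int.natAbs_eq n with h | h <;> rw [h] at hz
  · rwa [zpow_natCast] at hz
  · rwa [zpow_neg, inv_eq_one, zpow_natCast] at hz

/-- Cramer's rule for a pair of multiplicative relations. -/
theorem zpow_det_eq_one_of_zpow_mul_zpow_eq_one {K : Type*} [Field K] {s p : K}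
    (hs : s ≠ 0) (hp : p ≠ 0) {a b c d : ℤ}
    (h₁ : s ^ a * p ^ c = 1) (h₂ : s ^ b * p ^ d = 1) :
    s ^ (a * d - b * c) = 1 ∧ p ^ (a * d - b * c) = 1 := by
  constructor
  · calc s ^ (a * d - b * c) = (s ^ a * p ^ c) ^ d / (s ^ b * p ^ d) ^ c := by
          rw [mul_zpow, mul_zpow, ← zpow_mul, ← zpow_mul, ← zpow_mul, ← zpow_mul, mul_comm d c,
            mul_div_mul_right _ _ (zpow_ne_zero _ hp), zpow_sub₀ hs]
      _ = 1 := by simp [h₁, h₂]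
  · calc p ^ (a * d - b * c) = (s ^ b * p ^ d) ^ a / (s ^ a * p ^ c) ^ b := by
          rw [mul_zpow, mul_zpow, ← zpow_mul, ← zpow_mul, ← zpow_mul, ← zpow_mul, mul_comm b a,
            mul_div_mul_left _ _ (zpow_ne_zero _ hs), zpow_sub₀ hp, mul_comm d a, mul_comm c b]
      _ = 1 := by simp [h₁, h₂]

/-- Two multiplicative relations with nonzero determinant have finitely many common solutions. -/
theorem finite_setOf_zpow_mul_zpow_eq_one {K : Type*} [Field K] {a b c d : ℤ}
    (hdet : a * d - b * c ≠ 0) :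
    {sp : K × K | sp.1 ≠ 0 ∧ sp.2 ≠ 0 ∧
      sp.1 ^ a * sp.2 ^ c = 1 ∧ sp.1 ^ b * sp.2 ^ d = 1}.Finite :=
  ((finite_setOf_zpow_eq_one hdet).prod (finite_setOf_zpow_eq_one hdet)).subset
    fun _ ⟨hs, hp, h₁, h₂⟩ => zpow_det_eq_one_of_zpow_mul_zpow_eq_one hs hp h₁ h₂

/-- Key finiteness claim of Lemma 3.1: for integers `k1 k2 k3 k4` with
`k1*k4 - k2*k3 = 1` and `|k1 + k4| > 2`, the set of pairs `(s, p)` of nonzero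
complex numbers with `(s^k1 * p^k3, s^k2 * p^k4) = (s, p)` or `(s⁻¹, p⁻¹)` is finite. -/
theorem finite_reducible_pairs (k1 k2 k3 k4 : ℤ)
    (hdet : k1 * k4 - k2 * k3 = 1) (htr : 2 < |k1 + k4|) :
    {sp : ℂ × ℂ | sp.1 ≠ 0 ∧ sp.2 ≠ 0 ∧
      ((sp.1 ^ k1 * sp.2 ^ k3 = sp.1 ∧ sp.1 ^ k2 * sp.2 ^ k4 = sp.2) ∨
       (sp.1 ^ k1 * sp.2 ^ k3 = sp.1⁻¹ ∧ sp.1 ^ k2 * sp.2 ^ k4 = sp.2⁻¹))}.Finite := by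
  have hminus : (k1 - 1) * (k4 - 1) - k2 * k3 ≠ 0 := fun h => by
    have htr' : k1 + k4 = 2 := by linarith
    norm_num [htr'] at htr
  have hplus : (k1 + 1) * (k4 + 1) - k2 * k3 ≠ 0 := fun h => by
    have htr' : k1 + k4 = -2 := by linarith
    norm_num [htr'] at htr
  refine ((finite_setOf_zpow_mul_zpow_eq_one hminus).union
    (finite_setOf_zpow_mul_zpow_eq_one hplus)).subset ?_
  rintro ⟨s, p⟩ ⟨hs, hp, ⟨h₁, h₂⟩ | ⟨h₁, h₂⟩⟩ <;> dsimp only at hs hp h₁ h₂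
  · refine Or.inl ⟨hs, hp, ?_, ?_⟩ <;> dsimp only
    · rw [zpow_sub_one₀ hs, mul_right_comm, h₁, mul_inv_cancel₀ hs]
    · rw [zpow_sub_one₀ hp, ← mul_assoc, h₂, mul_inv_cancel₀ hp]
  · refine Or.inr ⟨hs, hp, ?_, ?_⟩ <;> dsimp only
    · rw [zpow_add_one₀ hs, mul_right_comm, h₁, inv_mul_cancel₀ hs]
    · rw [zpow_add_one₀ hp, ← mul_assoc, h₂, inv_mul_cancel₀ hp]
end

section
/- Let A and B be 2x2 complex matrices of determinant 1 satisfying A*B = -(B*A). Then tr(A) = 0, tr(B) = 0, and tr(A*B) = 0. -/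
/-- A square matrix that anticommutes with an invertible matrix has trace zero. -/
theorem Matrix.trace_eq_zero_of_mul_eq_neg_mul {n K : Type*} [Fintype n] [DecidableEq n]
    [Field K] [CharZero K] {A B : Matrix n n K} (hB : IsUnit B.det) (h : A * B = -(B * A)) :
    A.trace = 0 := by
  have key : A.trace = -A.trace := by
    calc A.trace = (A * B * B⁻¹).trace := by rw [Matrix.mul_nonsing_inv_cancel_right B A hB]
      _ = -(B * A * B⁻¹).trace := by rw [h, Matrix.neg_mul, Matrix.trace_neg]
      _ = -A.trace := by
        rw [Matrix.trace_mul_comm, Matrix.nonsing_inv_mul_cancel_left B A hB]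
  exact self_eq_neg.mp key

/-- If `A, B` are 2×2 complex matrices of determinant 1 with `A*B = -(B*A)`,
then `tr A = 0`, `tr B = 0` and `tr (A*B) = 0`. -/
theorem trace_eq_zero_of_anticommute (A B : Matrix (Fin 2) (Fin 2) ℂ)
    (hA : A.det = 1) (hB : B.det = 1) (h : A * B = -(B * A)) :
    A.trace = 0 ∧ B.trace = 0 ∧ (A * B).trace = 0 := by
  refine ⟨Matrix.trace_eq_zero_of_mul_eq_neg_mul (by simp [hB]) h,
    Matrix.trace_eq_zero_of_mul_eq_neg_mul (B := A) (by simp [hA]) (by rw [h, neg_neg]), ?_⟩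
  have key : (A * B).trace = -(A * B).trace := by
    conv_lhs => rw [h, Matrix.trace_neg, Matrix.trace_mul_comm]
  exact self_eq_neg.mp key
end

section
/- Let A, B be elements of SL(2,C) with tr(A*B*A^{-1}*B^{-1}) ≠ 2. Then there is no T in SL(2,C) such that tr(T) = 0, tr(A*T) = 0, tr(B*T) = 0, and tr(A*B*T) = 0 all hold simultaneously. -/
open Matrix

/-- The linear functionals `T ↦ tr T, tr (A T), tr (B T), tr (A B T)` on `2 × 2` matrices have
determinant `± (tr (A B adj A adj B) - 2 det A det B)`, which therefore annihilates every matrix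
in their common kernel. -/
lemma trace_commutator_sub_smul_eq_zero {R : Type*} [CommRing R]
    (A B T : Matrix (Fin 2) (Fin 2) R) (hT : T.trace = 0) (hAT : (A * T).trace = 0)
    (hBT : (B * T).trace = 0) (hABT : (A * B * T).trace = 0) :
    ((A * B * A.adjugate * B.adjugate).trace - 2 * (A.det * B.det)) • T = 0 := by
  obtain ⟨a, b, c, d, rfl⟩ : ∃ a b c d, A = !![a, b; c, d] := ⟨_, _, _, _, A.eta_fin_two⟩
  obtain ⟨e, f, g, h, rfl⟩ : ∃ e f g h, B = !![e, f; g, h] := ⟨_, _, _, _, B.eta_fin_two⟩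
  obtain ⟨t, u, v, w, rfl⟩ : ∃ t u v w, T = !![t, u; v, w] := ⟨_, _, _, _, T.eta_fin_two⟩
  simp only [trace_fin_two_of, mul_fin_two, adjugate_fin_two_of, det_fin_two_of] at *
  obtain rfl : w = -t := by linear_combination hT
  ext i j
  fin_cases i <;> fin_cases j <;> simp
  · linear_combination (f * (c * e + d * g) - g * (a * f + b * h)) * hAT
      + (c * (a * f + b * h) - b * (c * e + d * g)) * hBT + (b * g - c * f) * hABT
  · linear_combination
      ((e - h) * (a * f + b * h) - f * (a * e + b * g - (c * f + d * h))) * hAT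
      + (b * (a * e + b * g - (c * f + d * h)) - (a - d) * (a * f + b * h)) * hBT
      + ((a - d) * f - b * (e - h)) * hABT
  · linear_combination
      (g * (a * e + b * g - (c * f + d * h)) - (e - h) * (c * e + d * g)) * hAT
      + ((a - d) * (c * e + d * g) - c * (a * e + b * g - (c * f + d * h))) * hBT
      + (c * (e - h) - (a - d) * g) * hABT
  · linear_combination (f * (c * e + d * g) - g * (a * f + b * h)) * hAT
      + (c * (a * f + b * h) - b * (c * e + d * g)) * hBT + (b * g - c * f) * hABT

/-- Lemma 3.4 key computation: if `A, B ∈ SL(2,ℂ)` generate an irreducible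
subgroup (`tr(ABA⁻¹B⁻¹) ≠ 2`), then there is no `T ∈ SL(2,ℂ)` with
`tr T = tr(AT) = tr(BT) = tr(ABT) = 0`. -/
theorem no_trace_free_intertwiner (A B : Matrix.SpecialLinearGroup (Fin 2) ℂ)
    (h : Matrix.trace ((A * B * A⁻¹ * B⁻¹).val) ≠ 2) :
    ¬ ∃ T : Matrix.SpecialLinearGroup (Fin 2) ℂ,
      Matrix.trace T.val = 0 ∧
      Matrix.trace ((A * T).val) = 0 ∧
      Matrix.trace ((B * T).val) = 0 ∧
      Matrix.trace ((A * B * T).val) = 0 := by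
  rintro ⟨T, hT, hAT, hBT, hABT⟩
  have key := trace_commutator_sub_smul_eq_zero A.val B.val T.val hT
    (by simpa using hAT) (by simpa using hBT) (by simpa using hABT)
  have hT0 : T.val = 0 := by
    refine (smul_eq_zero.mp key).resolve_left fun h0 => h ?_
    simpa [sub_eq_zero] using h0
  simpa [hT0] using T.det_coe
end

section
/- The matrices A = [[1,1],[0,1]] and B = [[1,0],[-1,1]] generate SL(2,Z) as a monoid; that is, the submonoid of SL(2,Z) generated by {A, B} is all of SL(2,Z). In particular, every element of SL(2,Z) can be written as a product of positive powers of A and B. -/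
/-- The Dehn twist matrix `A = [[1,1],[0,1]]` as an element of `SL(2,ℤ)`. -/
def dehnA : Matrix.SpecialLinearGroup (Fin 2) ℤ :=
  ⟨!![1, 1; 0, 1], by simp [Matrix.det_fin_two_of]⟩

/-- The Dehn twist matrix `B = [[1,0],[-1,1]]` as an element of `SL(2,ℤ)`. -/
def dehnB : Matrix.SpecialLinearGroup (Fin 2) ℤ :=
  ⟨!![1, 0; -1, 1], by simp [Matrix.det_fin_two_of]⟩

theorem modularGroup_S_eq : ModularGroup.S = (dehnA * dehnB * dehnA) ^ 3 := by
  decide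

theorem modularGroup_T_eq : ModularGroup.T = dehnA := rfl

theorem dehnA_inv : dehnA⁻¹ = dehnB ^ 2 * dehnA * dehnB ^ 2 * dehnA * dehnB ^ 2 * dehnA *
    dehnB ^ 2 := by
  decide

theorem modularGroup_S_inv : ModularGroup.S⁻¹ = dehnA * dehnB * dehnA := by
  decide

/-- The matrices `A = [[1,1],[0,1]]` and `B = [[1,0],[-1,1]]` generate `SL(2,ℤ)`
as a monoid: every element of `SL(2,ℤ)` is a product of positive powers of `A` and `B`. -/
theorem dehn_twists_generate_monoid :
    Submonoid.closure ({dehnA, dehnB} : Set (Matrix.SpecialLinearGroup (Fin 2) ℤ)) = ⊤ := by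
  set M := Submonoid.closure ({dehnA, dehnB} : Set (Matrix.SpecialLinearGroup (Fin 2) ℤ))
  have hA : dehnA ∈ M := Submonoid.subset_closure (by simp)
  have hB : dehnB ∈ M := Submonoid.subset_closure (by simp)
  have hABA : dehnA * dehnB * dehnA ∈ M := mul_mem (mul_mem hA hB) hA
  have hB2 : dehnB ^ 2 ∈ M := pow_mem hB 2
  have hA_inv : dehnA⁻¹ ∈ M := by
    rw [dehnA_inv]
    exact mul_mem (mul_mem (mul_mem (mul_mem (mul_mem (mul_mem hB2 hA) hB2) hA) hB2) hA) hB2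
  rw [eq_top_iff, ← Subgroup.top_toSubmonoid,
    ← SpecialLinearGroup.SL2Z_generators, Subgroup.closure_toSubmonoid,
    Submonoid.closure_le]
  rintro g ((rfl | rfl) | hg)
  · rw [modularGroup_S_eq]
    exact pow_mem hABA 3
  · rw [modularGroup_T_eq]
    exact hA
  · rcases hg with hg | hg
    · rw [← inv_inv g, hg, modularGroup_S_inv]
      exact hABA
    · rw [← inv_inv g, hg]
      exact hA_inv
end

section
/- Let alphabar, betainvbar : C^3 -> C^3 be the polynomial maps alphabar(x,y,z) = (x, z, x*z - y) and betainvbar(x,y,z) = (z, y, y*z - x), and let A = [[1,1],[0,1]] and Binv = [[1,0],[1,1]] in SL(2,Z). Given a finite word w in two letters, let phibar_w : C^3 -> C^3 be the corresponding composition of the maps alphabar and betainvbar, and let M_w in SL(2,Z) be the corresponding product of the matrices A and Binv. If the reduction of M_w modulo 2 is the identity matrix, then the fixed-point set {v in C^3 : phibar_w(v) = v} contains at least one of the three coordinate axes L1 = {(t,0,0)}, L2 = {(0,t,0)}, L3 = {(0,0,t)}; moreover it contains either exactly one of them or all three of them, and the fixed-point set of phibar_w composed with itself contains all three coordinate axes.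 -/
/-- The polynomial automorphism of `X(S) = ℂ³` induced by the Dehn twist `α`. -/
noncomputable def alphabar : ℂ × ℂ × ℂ → ℂ × ℂ × ℂ :=
  fun p => (p.1, p.2.2, p.1 * p.2.2 - p.2.1)

/-- The polynomial automorphism of `X(S) = ℂ³` induced by the Dehn twist `β⁻¹`. -/
noncomputable def betainvbar : ℂ × ℂ × ℂ → ℂ × ℂ × ℂ :=
  fun p => (p.2.2, p.2.1, p.2.1 * p.2.2 - p.1)

/-- The matrix `A = [[1,1],[0,1]]` in `SL(2,ℤ)`. -/
def matA : Matrix.SpecialLinearGroup (Fin 2) ℤ :=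
  ⟨!![1, 1; 0, 1], by simp [Matrix.det_fin_two_of]⟩

/-- The matrix `B⁻¹ = [[1,0],[1,1]]` in `SL(2,ℤ)`. -/
def matBinv : Matrix.SpecialLinearGroup (Fin 2) ℤ :=
  ⟨!![1, 0; 1, 1], by simp [Matrix.det_fin_two_of]⟩

/-- Letter-wise assignment of polynomial maps. -/
noncomputable def phimap : Bool → (ℂ × ℂ × ℂ → ℂ × ℂ × ℂ) :=
  fun b => if b then alphabar else betainvbar

/-- Letter-wise assignment of matrices. -/
def matmap : Bool → Matrix.SpecialLinearGroup (Fin 2) ℤ :=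
  fun b => if b then matA else matBinv

/-- The polynomial map `φ̄_w` associated to a word `w` in the two letters. -/
noncomputable def phibar (w : List Bool) : ℂ × ℂ × ℂ → ℂ × ℂ × ℂ :=
  (w.map phimap).foldr (· ∘ ·) id

/-- The `x`-axis in `ℂ³`. -/
def axisL1 : Set (ℂ × ℂ × ℂ) := {v | v.2.1 = 0 ∧ v.2.2 = 0}

/-- The `y`-axis in `ℂ³`. -/
def axisL2 : Set (ℂ × ℂ × ℂ) := {v | v.1 = 0 ∧ v.2.2 = 0}

/-- The `z`-axis in `ℂ³`. -/
def axisL3 : Set (ℂ × ℂ × ℂ) := {v | v.1 = 0 ∧ v.2.1 = 0}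

/-- The point with parameter `t` on the `i`-th coordinate axis of `ℂ³`. -/
noncomputable def axisPoint (i : Fin 3) (t : ℂ) : ℂ × ℂ × ℂ :=
  (if i = 0 then t else 0, if i = 1 then t else 0, if i = 2 then t else 0)

theorem axisPoint_injective (i : Fin 3) : Function.Injective (axisPoint i) := by
  intro s t h
  fin_cases i <;> simpa [axisPoint] using h

theorem axisL1_eq_range : axisL1 = Set.range (axisPoint 0) := by
  ext ⟨x, y, z⟩
  simp [axisL1, axisPoint, eq_comm]

theorem axisL2_eq_range : axisL2 = Set.range (axisPoint 1) := by
  ext ⟨x, y, z⟩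
  simp [axisL2, axisPoint, eq_comm]

theorem axisL3_eq_range : axisL3 = Set.range (axisPoint 2) := by
  ext ⟨x, y, z⟩
  simp [axisL3, axisPoint, eq_comm]

/-- The transposition of the coordinate axes induced by a letter. -/
def letterPerm (b : Bool) : Equiv.Perm (Fin 3) :=
  if b then Equiv.swap 1 2 else Equiv.swap 0 2

/-- The signs with which a letter permutes the coordinate axes. -/
def letterSign (b : Bool) : Fin 3 → ℤˣ :=
  if b then ![1, -1, 1] else ![-1, 1, 1]

/-- The permutation of the coordinate axes induced by a word. -/
def wordPerm (w : List Bool) : Equiv.Perm (Fin 3) :=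
  (w.map letterPerm).prod

theorem phimap_axisPoint (b : Bool) (i : Fin 3) (t : ℂ) :
    phimap b (axisPoint i t) = axisPoint (letterPerm b i) ((letterSign b i : ℤ) * t) := by
  cases b <;> fin_cases i <;>
    simp [phimap, alphabar, betainvbar, axisPoint, letterPerm, letterSign,
      Equiv.swap_apply_def]

theorem prod_letterSign (b : Bool) :
    ∏ i, letterSign b i = Equiv.Perm.sign (letterPerm b) := by
  cases b <;> decide

/-- A word acts on the coordinate axes as a signed permutation of determinant one. -/
theorem exists_phibar_axisPoint (w : List Bool) :
    ∃ s : Fin 3 → ℤˣ, ∏ i, s i = Equiv.Perm.sign (wordPerm w) ∧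
      ∀ i t, phibar w (axisPoint i t) = axisPoint (wordPerm w i) ((s i : ℤ) * t) := by
  induction w with
  | nil => exact ⟨1, by simp [wordPerm], by simp [wordPerm, phibar]⟩
  | cons b w ih =>
    obtain ⟨s, hs, hw⟩ := ih
    have hperm : wordPerm (b :: w) = letterPerm b * wordPerm w := by simp [wordPerm]
    refine ⟨fun i => letterSign b (wordPerm w i) * s i, ?_, fun i t => ?_⟩
    · rw [Finset.prod_mul_distrib, Equiv.prod_comp (wordPerm w) (letterSign b), hs,
        prod_letterSign, hperm, map_mul]
    · have hcons : phibar (b :: w) (axisPoint i t) = phimap b (phibar w (axisPoint i t)) := by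
        simp [phibar]
      rw [hcons, hw, phimap_axisPoint, hperm]
      simp [mul_assoc]

/-- The nonzero mod 2 homology classes, indexed by the coordinate axes. -/
def axisClass : Fin 3 → Fin 2 → ZMod 2 :=
  ![![1, 0], ![0, 1], ![1, 1]]

theorem axisClass_injective : Function.Injective axisClass := by
  decide

/-- The reduction modulo 2 of an integral matrix of determinant one. -/
abbrev redMod2 (M : Matrix.SpecialLinearGroup (Fin 2) ℤ) : Matrix (Fin 2) (Fin 2) (ZMod 2) :=
  (Matrix.SpecialLinearGroup.map (Int.castRingHom (ZMod 2)) M).1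

theorem redMod2_matmap_mulVec (b : Bool) (i : Fin 3) :
    (redMod2 (matmap b)).mulVec (axisClass i) = axisClass (letterPerm b i) := by
  revert b i
  decide

theorem redMod2_prod_mulVec (w : List Bool) (i : Fin 3) :
    (redMod2 (w.map matmap).prod).mulVec (axisClass i) = axisClass (wordPerm w i) := by
  induction w with
  | nil => simp [redMod2, wordPerm]
  | cons b w ih =>
    have hmul : redMod2 ((b :: w).map matmap).prod =
        redMod2 (matmap b) * redMod2 (w.map matmap).prod := by
      simp [redMod2]
    have hperm : wordPerm (b :: w) i = letterPerm b (wordPerm w i) := by simp [wordPerm]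
    rw [hmul, ← Matrix.mulVec_mulVec, ih, redMod2_matmap_mulVec, hperm]

theorem wordPerm_eq_one (w : List Bool)
    (h : Matrix.SpecialLinearGroup.map (Int.castRingHom (ZMod 2)) (w.map matmap).prod = 1) :
    wordPerm w = 1 := by
  ext1 i
  apply axisClass_injective
  rw [← redMod2_prod_mulVec, redMod2, h]
  simp

theorem range_axisPoint_subset_fixed_iff {f : ℂ × ℂ × ℂ → ℂ × ℂ × ℂ} {i : Fin 3} {u : ℤˣ}
    (hf : ∀ t, f (axisPoint i t) = axisPoint i ((u : ℤ) * t)) :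
    Set.range (axisPoint i) ⊆ {v | f v = v} ↔ u = 1 := by
  rw [Set.range_subset_iff]
  simp only [Set.mem_ofPred_eq, hf, (axisPoint_injective i).eq_iff]
  constructor
  · intro h
    have h1 := h 1
    rw [mul_one] at h1
    exact Units.ext (Int.cast_eq_one.mp h1)
  · rintro rfl t
    simp

theorem range_axisPoint_subset_fixed_comp {f : ℂ × ℂ × ℂ → ℂ × ℂ × ℂ} {i : Fin 3} {u : ℤˣ}
    (hf : ∀ t, f (axisPoint i t) = axisPoint i ((u : ℤ) * t)) :
    Set.range (axisPoint i) ⊆ {v | f (f v) = v} := by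
  rintro _ ⟨t, rfl⟩
  rcases Int.units_eq_one_or u with rfl | rfl <;> simp [hf]

/-- Lemma 3.2: if the product matrix of the word `w` reduces to the identity mod 2,
then the fixed-point set of `φ̄_w` contains at least one coordinate axis — in fact
either exactly one or all three — and the fixed-point set of `φ̄_w ∘ φ̄_w` contains
all three coordinate axes. -/
theorem axes_in_fixed_point_set (w : List Bool)
    (h : Matrix.SpecialLinearGroup.map (Int.castRingHom (ZMod 2)) ((w.map matmap).prod) = 1) :
    (axisL1 ⊆ {v | phibar w v = v} ∨ axisL2 ⊆ {v | phibar w v = v} ∨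
      axisL3 ⊆ {v | phibar w v = v}) ∧
    ((axisL1 ⊆ {v | phibar w v = v} ∧ axisL2 ⊆ {v | phibar w v = v} ∧
        axisL3 ⊆ {v | phibar w v = v}) ∨
     (axisL1 ⊆ {v | phibar w v = v} ∧ ¬ axisL2 ⊆ {v | phibar w v = v} ∧
        ¬ axisL3 ⊆ {v | phibar w v = v}) ∨
     (¬ axisL1 ⊆ {v | phibar w v = v} ∧ axisL2 ⊆ {v | phibar w v = v} ∧
        ¬ axisL3 ⊆ {v | phibar w v = v}) ∨
     (¬ axisL1 ⊆ {v | phibar w v = v} ∧ ¬ axisL2 ⊆ {v | phibar w v = v} ∧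
        axisL3 ⊆ {v | phibar w v = v})) ∧
    (axisL1 ⊆ {v | phibar w (phibar w v) = v} ∧
     axisL2 ⊆ {v | phibar w (phibar w v) = v} ∧
     axisL3 ⊆ {v | phibar w (phibar w v) = v}) := by
  obtain ⟨s, hs, hw⟩ := exists_phibar_axisPoint w
  simp only [wordPerm_eq_one w h, Equiv.Perm.one_apply] at hw
  rw [wordPerm_eq_one w h, map_one, Fin.prod_univ_three] at hs
  rw [axisL1_eq_range, axisL2_eq_range, axisL3_eq_range]
  refine and_assoc.mp ⟨?_, range_axisPoint_subset_fixed_comp (hw 0),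
    range_axisPoint_subset_fixed_comp (hw 1), range_axisPoint_subset_fixed_comp (hw 2)⟩
  simp only [range_axisPoint_subset_fixed_iff (hw _)]
  generalize s 0 = a, s 1 = b, s 2 = c at hs
  revert a b c
  decide
end

section
/- Let f_n in C[u] be the Fibonacci polynomials, defined by f_0 = 0, f_1 = 1, and f_n = u*f_{n-1} - f_{n-2}. Then for every natural number n: the polynomial f_n is separable whenever n ≠ 0, and the polynomials f_{n+1} - f_n, f_{n+1} + f_n, and f_{n+2} - f_n are all separable. -/
/-- The Fibonacci polynomials `f₀ = 0`, `f₁ = 1`, `fₙ = u·fₙ₋₁ - fₙ₋₂`. -/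
noncomputable def fibP : ℕ → Polynomial ℂ
  | 0 => 0
  | 1 => 1
  | (n + 2) => Polynomial.X * fibP (n + 1) - fibP n

theorem fibP_add_two (n : ℕ) : fibP (n + 2) = Polynomial.X * fibP (n + 1) - fibP n := by
  rw [fibP]

theorem fibP_add_add_one (m n : ℕ) :
    fibP (m + n + 1) = fibP (m + 1) * fibP (n + 1) - fibP m * fibP n := by
  induction m generalizing n with
  | zero => simp [fibP]
  | succ m ih =>
    rw [show m + 1 + n + 1 = m + (n + 1) + 1 by ring, ih, fibP_add_two, fibP_add_two]
    ring

theorem fibP_sq_add_sq (n : ℕ) :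
    fibP n ^ 2 + fibP (n + 1) ^ 2 - Polynomial.X * fibP n * fibP (n + 1) = 1 := by
  induction n with
  | zero => simp [fibP]
  | succ n ih =>
    rw [fibP_add_two]
    linear_combination ih

theorem X_sq_sub_four_mul_derivative_fibP (n : ℕ) :
    (Polynomial.X ^ 2 - 4) * (fibP n).derivative =
      (n : Polynomial ℂ) * (2 * fibP (n + 1) - Polynomial.X * fibP n) - Polynomial.X * fibP n := by
  induction n using Nat.twoStepInduction with
  | zero => simp [fibP]
  | one =>
    simp [fibP]
    ring
  | more n ih₀ ih₁ =>
    rw [fibP_add_two (n + 1)]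
    rw [fibP_add_two] at ih₁ ⊢
    simp only [Polynomial.derivative_sub, Polynomial.derivative_mul, Polynomial.derivative_X]
    push_cast at ih₁ ⊢
    linear_combination Polynomial.X * ih₁ - ih₀

theorem separable_fibP_of_ne_zero {n : ℕ} (hn : n ≠ 0) : (fibP n).Separable := by
  have hinv : Polynomial.C ((2 * n : ℂ)⁻¹) * (2 * n) = 1 := by
    have h : (2 * n : ℂ) ≠ 0 := by simpa using hn
    rw [show (2 * n : Polynomial ℂ) = Polynomial.C (2 * n : ℂ) by simp [Polynomial.C_ofNat],
      ← Polynomial.C_mul, inv_mul_cancel₀ h, Polynomial.C_1]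
  rw [Polynomial.separable_def']
  refine ⟨fibP n - Polynomial.X * fibP (n + 1) +
      Polynomial.C ((2 * n : ℂ)⁻¹) * fibP (n + 1) * (((n : Polynomial ℂ) + 1) * Polynomial.X),
    Polynomial.C ((2 * n : ℂ)⁻¹) * fibP (n + 1) * (Polynomial.X ^ 2 - 4), ?_⟩
  linear_combination fibP_sq_add_sq n + fibP (n + 1) ^ 2 * hinv +
    Polynomial.C ((2 * n : ℂ)⁻¹) * fibP (n + 1) * X_sq_sub_four_mul_derivative_fibP n

/-- Lemma 5.2 (4): for every `n`, the polynomial `fₙ` (for `n ≠ 0`) and the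
polynomials `fₙ₊₁ - fₙ`, `fₙ₊₁ + fₙ` and `fₙ₊₂ - fₙ` are separable. -/
theorem fibP_separable (n : ℕ) :
    (n ≠ 0 → (fibP n).Separable) ∧
    (fibP (n + 1) - fibP n).Separable ∧
    (fibP (n + 1) + fibP n).Separable ∧
    (fibP (n + 2) - fibP n).Separable := by
  have hodd : (fibP (n + n + 1)).Separable := separable_fibP_of_ne_zero (by omega)
  have heven : (fibP (n + (n + 1) + 1)).Separable := separable_fibP_of_ne_zero (by omega)
  rw [fibP_add_add_one] at hodd heven
  exact ⟨separable_fibP_of_ne_zero, hodd.of_dvd ⟨fibP (n + 1) + fibP n, by ring⟩,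
    hodd.of_dvd ⟨fibP (n + 1) - fibP n, by ring⟩, heven.of_dvd ⟨fibP (n + 1), by ring⟩⟩
end

section
/- Let f_n in C[u] be the Fibonacci polynomials, defined by f_0 = 0, f_1 = 1, and f_n = u*f_{n-1} - f_{n-2}. Then for every natural number n, the polynomials f_{n+2} - f_{n+1} and f_{n+1} - f_n have no common root in C; that is, there is no z in C with (f_{n+2} - f_{n+1})(z) = 0 and (f_{n+1} - f_n)(z) = 0. -/
/-- Lemma 5.2 (5): `fₙ₊₂ - fₙ₊₁` and `fₙ₊₁ - fₙ` have no common root. -/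
theorem fibP_no_common_root (n : ℕ) :
    ¬ ∃ z : ℂ, (fibP (n + 2) - fibP (n + 1)).eval z = 0 ∧
      (fibP (n + 1) - fibP n).eval z = 0 := by
  rintro ⟨z, h₁, h₀⟩
  induction n with
  | zero => simp [fibP] at h₀
  | succ n ih =>
    refine ih h₀ ?_
    have h₃ : fibP (n + 3) = Polynomial.X * fibP (n + 2) - fibP (n + 1) := by rw [fibP]
    have h₂ : fibP (n + 2) = Polynomial.X * fibP (n + 1) - fibP n := by rw [fibP]
    have key : fibP (n + 1) - fibP n =
        Polynomial.X * (fibP (n + 2) - fibP (n + 1)) - (fibP (n + 3) - fibP (n + 2)) := by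
      linear_combination h₃ - h₂
    rw [key, Polynomial.eval_sub, Polynomial.eval_mul, h₀, h₁, mul_zero, sub_zero]
end

section
/- Let A, B be elements of SL(2,C) and let f_n in C[u] be the Fibonacci polynomials, defined by f_0 = 0, f_1 = 1, and f_n = u*f_{n-1} - f_{n-2}. Then for every natural number n, tr(A * (A^{-1}*B^{-1})^{n+1}) = tr(B) * f_{n+1}(tr(A*B)) - tr(A) * f_n(tr(A*B)), where f_m(c) denotes the evaluation of f_m at c in C. -/
namespace Matrix.SpecialLinearGroup

/-- Inversion in `SL(2, R)` preserves the trace. -/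
theorem trace_inv_fin_two {R : Type*} [CommRing R] (C : SpecialLinearGroup (Fin 2) R) :
    trace (C⁻¹).val = trace C.val := by
  rw [coe_inv, adjugate_fin_two, trace_fin_two, trace_fin_two]
  simp [add_comm]

/-- The Cayley–Hamilton relation in `SL(2, R)`. -/
theorem coe_mul_self_fin_two {R : Type*} [CommRing R] (C : SpecialLinearGroup (Fin 2) R) :
    C.val * C.val = trace C.val • C.val - 1 := by
  have hdet := C.det_coe
  rw [det_fin_two] at hdet
  ext i j
  fin_cases i <;> fin_cases j <;> simp [mul_apply, trace_fin_two]
  · linear_combination -hdet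
  · ring
  · ring
  · linear_combination -hdet

/-- Powers in `SL(2, ℂ)` expressed through Fibonacci polynomials in the trace. -/
theorem coe_pow_succ_eq_fibP (C : SpecialLinearGroup (Fin 2) ℂ) (n : ℕ) :
    C.val ^ (n + 1) =
      (fibP (n + 1)).eval (trace C.val) • C.val - (fibP n).eval (trace C.val) • 1 := by
  induction n with
  | zero => simp [fibP]
  | succ n ih =>
    rw [pow_succ, ih, sub_mul, smul_mul_assoc, coe_mul_self_fin_two, smul_mul_assoc, one_mul,
      fibP, Polynomial.eval_sub, Polynomial.eval_mul, Polynomial.eval_X]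
    module

end Matrix.SpecialLinearGroup

open Matrix.SpecialLinearGroup in
/-- Closed form for the trace polynomials `Pₙ = tr(A (A⁻¹B⁻¹)ⁿ)`:
`tr(A (A⁻¹B⁻¹)^(n+1)) = tr(B)·f_{n+1}(tr AB) - tr(A)·f_n(tr AB)`. -/
theorem trace_P_closed_form (A B : Matrix.SpecialLinearGroup (Fin 2) ℂ) (n : ℕ) :
    Matrix.trace ((A * (A⁻¹ * B⁻¹) ^ (n + 1)).val) =
      Matrix.trace B.val * (fibP (n + 1)).eval (Matrix.trace ((A * B).val)) -
      Matrix.trace A.val * (fibP n).eval (Matrix.trace ((A * B).val)) := by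
  have htrace : Matrix.trace (A⁻¹ * B⁻¹).val = Matrix.trace (A * B).val := by
    rw [← mul_inv_rev, trace_inv_fin_two, coe_mul, coe_mul, Matrix.trace_mul_comm]
  rw [coe_mul, coe_pow, coe_pow_succ_eq_fibP, htrace, mul_sub, mul_smul_comm, mul_smul_comm,
    ← coe_mul, mul_inv_cancel_left, mul_one, Matrix.trace_sub, Matrix.trace_smul,
    Matrix.trace_smul, trace_inv_fin_two, smul_eq_mul, smul_eq_mul, mul_comm (Matrix.trace B.val),
    mul_comm (Matrix.trace A.val)]
end

section
/- Let A, B be elements of SL(2,C) and let f_n in C[u] be the Fibonacci polynomials, defined by f_0 = 0, f_1 = 1, and f_n = u*f_{n-1} - f_{n-2}. Set w = tr(A)*tr(A*B) - tr(B). Then for every natural number n, tr(A * (A^{-2}*B^{-1})^{n+1}) = tr(A*B) * f_{n+1}(w) - tr(A) * f_n(w), where f_m(c) denotes the evaluation of f_m at c in C. -/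
open Matrix in
/-- Cayley–Hamilton in `SL(2, R)`, in trace form. -/
theorem trace_mul_sq_mul {R : Type*} [CommRing R] (G M : SpecialLinearGroup (Fin 2) R) :
    trace (G * M ^ 2).val = trace M.val * trace (G * M).val - trace G.val := by
  have hM := M.det_coe
  rw [det_fin_two] at hM
  rw [pow_two]
  change trace (G.val * (M.val * M.val)) = trace M.val * trace (G.val * M.val) - trace G.val
  simp only [trace_fin_two, mul_apply, Fin.sum_univ_two]
  linear_combination (-(G.val 0 0) - G.val 1 1) * hM

open Matrix in
theorem trace_coe_inv {R : Type*} [CommRing R] (M : SpecialLinearGroup (Fin 2) R) :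
    trace (M⁻¹).val = trace M.val := by
  simp [adjugate_fin_two, trace_fin_two, add_comm]

open Matrix in
theorem trace_coe_mul_comm {R : Type*} [CommRing R] (M N : SpecialLinearGroup (Fin 2) R) :
    trace (M * N).val = trace (N * M).val :=
  trace_mul_comm M.val N.val

open Matrix in
theorem trace_inv_sq_mul_inv {R : Type*} [CommRing R] (A B : SpecialLinearGroup (Fin 2) R) :
    trace ((A ^ 2)⁻¹ * B⁻¹).val = trace A.val * trace (A * B).val - trace B.val := by
  rw [← _root_.mul_inv_rev, trace_coe_inv, trace_mul_sq_mul, trace_coe_mul_comm B A]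

open Matrix in
theorem trace_mul_inv_sq_mul_inv {R : Type*} [CommRing R] (A B : SpecialLinearGroup (Fin 2) R) :
    trace (A * ((A ^ 2)⁻¹ * B⁻¹)).val = trace (A * B).val := by
  have h : A * ((A ^ 2)⁻¹ * B⁻¹) = (B * A)⁻¹ := by group
  rw [h, trace_coe_inv, trace_coe_mul_comm]

/-- Closed form for the trace polynomials `Qₙ = tr(A (A⁻²B⁻¹)ⁿ)`: with
`w = tr(A)·tr(AB) - tr(B)`, we have
`tr(A (A⁻²B⁻¹)^(n+1)) = tr(AB)·f_{n+1}(w) - tr(A)·f_n(w)`. -/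
theorem trace_Q_closed_form (A B : Matrix.SpecialLinearGroup (Fin 2) ℂ) (n : ℕ) :
    Matrix.trace ((A * ((A ^ 2)⁻¹ * B⁻¹) ^ (n + 1)).val) =
      Matrix.trace ((A * B).val) *
        (fibP (n + 1)).eval
          (Matrix.trace A.val * Matrix.trace ((A * B).val) - Matrix.trace B.val) -
      Matrix.trace A.val *
        (fibP n).eval
          (Matrix.trace A.val * Matrix.trace ((A * B).val) - Matrix.trace B.val) := by
  rw [← trace_inv_sq_mul_inv]
  induction n using Nat.twoStepInduction with
  | zero =>
    rw [zero_add, pow_one, trace_mul_inv_sq_mul_inv]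
    simp [fibP]
  | one =>
    rw [trace_mul_sq_mul, trace_mul_inv_sq_mul_inv]
    simp [fibP]
    ring
  | more n ih₀ ih₁ =>
    rw [pow_add _ (n + 1) 2, ← mul_assoc, trace_mul_sq_mul, mul_assoc A, ← pow_succ, ih₀, ih₁]
    simp only [fibP, Polynomial.eval_sub, Polynomial.eval_mul, Polynomial.eval_X]
    ring
end

section
/- In the polynomial ring C[x,y,z], define P_n by P_0 = x, P_1 = y, and P_{n+2} = z*P_{n+1} - P_n. Then for every natural number k: the ideal generated by {P_{2k+3} - x, P_{2k+2} - y} equals the principal ideal generated by P_{k+2} - P_{k+1}; and the ideal generated by {P_{2k+2} - x, P_{2k+1} - y} equals the principal ideal generated by P_{k+2} - P_k. -/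
open MvPolynomial

/-- The trace polynomials `P₀ = x`, `P₁ = y`, `Pₙ₊₂ = z·Pₙ₊₁ - Pₙ` in `ℂ[x,y,z]`. -/
noncomputable def traceP : ℕ → MvPolynomial (Fin 3) ℂ
  | 0 => X 0
  | 1 => X 1
  | (n + 2) => X 2 * traceP (n + 1) - traceP n

theorem Ideal.span_pair_mul_sub {R : Type*} [CommRing R] (z u v : R) :
    Ideal.span {z * u - v, u} = Ideal.span {u, v} := by
  apply le_antisymm <;> rw [Ideal.span_le, Set.pair_subset_iff] <;>
    simp only [SetLike.mem_coe, Ideal.mem_span_pair]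
  · exact ⟨⟨z, -1, by ring⟩, 1, 0, by ring⟩
  · exact ⟨⟨0, 1, by ring⟩, -1, z, by ring⟩

/-- The ideal generated by two consecutive differences `Pₘ - Pₙ`, `Pₘ₋₁ - Pₙ₊₁` is unchanged when
the indices are moved towards each other. -/
theorem span_traceP_sub_shift (a b j : ℕ) :
    Ideal.span {traceP (a + j + 1) - traceP b, traceP (a + j) - traceP (b + 1)} =
      Ideal.span {traceP (a + 1) - traceP (b + j), traceP a - traceP (b + j + 1)} := by
  induction j generalizing b with
  | zero => rfl
  | succ j ih =>
    have h : traceP (a + (j + 1) + 1) - traceP b =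
        X 2 * (traceP (a + j + 1) - traceP (b + 1)) - (traceP (a + j) - traceP (b + 1 + 1)) := by
      rw [← add_assoc a, traceP, traceP]
      ring
    rw [h, ← add_assoc a, Ideal.span_pair_mul_sub, ih, add_right_comm b 1 j, add_assoc b j 1]

/-- Lemma 5.7 ('S-polynomials'): the ideal `⟨P_{2k+3} - x, P_{2k+2} - y⟩` equals
`⟨P_{k+2} - P_{k+1}⟩`, and `⟨P_{2k+2} - x, P_{2k+1} - y⟩` equals `⟨P_{k+2} - P_k⟩`. -/
theorem traceP_ideal_reduction (k : ℕ) :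
    Ideal.span ({traceP (2 * k + 3) - X 0, traceP (2 * k + 2) - X 1} :
        Set (MvPolynomial (Fin 3) ℂ)) =
      Ideal.span {traceP (k + 2) - traceP (k + 1)} ∧
    Ideal.span ({traceP (2 * k + 2) - X 0, traceP (2 * k + 1) - X 1} :
        Set (MvPolynomial (Fin 3) ℂ)) =
      Ideal.span {traceP (k + 2) - traceP k} := by
  constructor
  · have h := span_traceP_sub_shift (k + 1) 0 (k + 1)
    rw [show k + 1 + (k + 1) = 2 * k + 2 by ring, zero_add, zero_add,
      ← neg_sub (traceP (k + 1 + 1)), traceP, traceP] at h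
    rw [h]
    apply le_antisymm
    · rw [Ideal.span_le, Set.pair_subset_iff]
      exact ⟨Ideal.mem_span_singleton_self _, neg_mem (Ideal.mem_span_singleton_self _)⟩
    · exact Ideal.span_mono (by simp)
  · have h := span_traceP_sub_shift (k + 1) 0 k
    rw [show k + 1 + k = 2 * k + 1 by ring, zero_add, zero_add, sub_self, Set.pair_comm _ 0,
      Ideal.span_insert_zero] at h
    simpa only [traceP] using h
end

section
/- Let f_n in C[u] be the Fibonacci polynomials, defined by f_0 = 0, f_1 = 1, and f_n = u*f_{n-1} - f_{n-2}. For every positive integer k, the polynomial g_k(x,y) = y*(f_{k+2}(y) - f_{k+1}(y)) - x*(f_{k+1}(y) - f_k(y)) is irreducible in the polynomial ring C[x,y]. -/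
/-- The Fibonacci polynomial `fₘ` with variable the second variable `y` of `ℂ[x,y]`. -/
noncomputable def fibY (m : ℕ) : MvPolynomial (Fin 2) ℂ :=
  Polynomial.aeval (MvPolynomial.X 1) (fibP m)

/-- The polynomial `g_k(x,y) = y(f_{k+2}(y) - f_{k+1}(y)) - x(f_{k+1}(y) - f_k(y))`. -/
noncomputable def gPoly (k : ℕ) : MvPolynomial (Fin 2) ℂ :=
  MvPolynomial.X 1 * (fibY (k + 2) - fibY (k + 1)) -
    MvPolynomial.X 0 * (fibY (k + 1) - fibY k)

open Polynomial in
/-- Consecutive differences of Fibonacci polynomials satisfy the Fibonacci recursion. -/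
theorem fibP_sub_succ (n : ℕ) :
    fibP (n + 3) - fibP (n + 2) =
      X * (fibP (n + 2) - fibP (n + 1)) - (fibP (n + 1) - fibP n) := by
  rw [fibP, fibP]
  ring

open Polynomial in
theorem isCoprime_X_fibP_sub (n : ℕ) : IsCoprime X (fibP (n + 1) - fibP n) := by
  induction n using Nat.twoStepInduction with
  | zero => simpa [fibP] using isCoprime_one_right
  | one => exact ⟨1, -1, by simp [fibP]⟩
  | more n ih _ =>
    rw [fibP_sub_succ, sub_eq_neg_add]
    exact ih.neg_right.add_mul_left_right _

theorem isCoprime_fibP_sub_succ (n : ℕ) :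
    IsCoprime (fibP (n + 1) - fibP n) (fibP (n + 2) - fibP (n + 1)) := by
  induction n with
  | zero => simpa [fibP] using isCoprime_one_left
  | succ n ih =>
    rw [fibP_sub_succ, sub_eq_neg_add (Polynomial.X * _)]
    exact ih.symm.neg_right.add_mul_right_right _

theorem fibP_sub_ne_zero (n : ℕ) : fibP (n + 1) - fibP n ≠ 0 := fun h =>
  Polynomial.not_isUnit_X (isCoprime_zero_right.mp (h ▸ isCoprime_X_fibP_sub n))

/-- A polynomial in the variable `X i` involves no other variable. -/
theorem MvPolynomial.notMem_vars_aeval_X {σ R : Type*} [CommSemiring R] {i j : σ} (hij : j ≠ i)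
    (p : Polynomial R) : j ∉ (Polynomial.aeval (MvPolynomial.X i : MvPolynomial σ R) p).vars := by
  have h : Polynomial.aeval (MvPolynomial.X i) p ∈ MvPolynomial.supported R {i} := by
    rw [MvPolynomial.supported, Set.image_singleton]
    exact Polynomial.aeval_mem_adjoin_singleton R _
  exact fun hj => hij (MvPolynomial.mem_supported.mp h hj)

theorem MvPolynomial.aeval_X_injective {σ R : Type*} [CommSemiring R] (i : σ) :
    Function.Injective (Polynomial.aeval (R := R) (MvPolynomial.X i : MvPolynomial σ R)) := by
  refine Function.LeftInverse.injective
    (g := MvPolynomial.aeval fun _ => (Polynomial.X : Polynomial R)) fun p => ?_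
  rw [← Polynomial.aeval_algHom_apply]
  simp

/-- Lemma 5.8: `g_k` is irreducible in `ℂ[x,y]` for every positive integer `k`. -/
theorem gPoly_irreducible (k : ℕ) (hk : 1 ≤ k) : Irreducible (gPoly k) := by
  let φ : Polynomial ℂ →ₐ[ℂ] MvPolynomial (Fin 2) ℂ := Polynomial.aeval (MvPolynomial.X 1)
  have hg : gPoly k = φ (-(fibP (k + 1) - fibP k)) * MvPolynomial.X 0 +
      φ (Polynomial.X * (fibP (k + 2) - fibP (k + 1))) := by
    simp only [gPoly, fibY, φ, map_neg, map_sub, map_mul, Polynomial.aeval_X]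
    ring
  rw [hg]
  refine MvPolynomial.irreducible_mul_X_add _ _ 0 ?_
    (MvPolynomial.notMem_vars_aeval_X (by decide) _)
    (MvPolynomial.notMem_vars_aeval_X (by decide) _) (IsCoprime.isRelPrime ?_)
  · exact (map_ne_zero_iff φ (MvPolynomial.aeval_X_injective 1)).mpr
      (neg_ne_zero.mpr (fibP_sub_ne_zero k))
  · exact ((isCoprime_X_fibP_sub k).symm.mul_right (isCoprime_fibP_sub_succ k)).neg_left.map
      φ.toRingHom
end

section
/- Let f_n in C[u] be the Fibonacci polynomials, defined by f_0 = 0, f_1 = 1, and f_n = u*f_{n-1} - f_{n-2}, and for a positive integer k let g_k(x,y) = y*(f_{k+2}(y) - f_{k+1}(y)) - x*(f_{k+1}(y) - f_k(y)) in C[x,y]. Then for every k ≥ 1 there is no point (x,y) in C^2 at which g_k and both of its partial derivatives with respect to x and y vanish simultaneously; that is, the affine plane curve g_k = 0 has no singular points. -/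
theorem eval_fibP_add_two (n : ℕ) (y : ℂ) :
    (fibP (n + 2)).eval y = y * (fibP (n + 1)).eval y - (fibP n).eval y := by
  simp [fibP]

/-- Consecutive differences of Fibonacci polynomials have no common root. -/
theorem eval_fibP_sub_ne_zero_of_eval_fibP_sub_eq_zero (y : ℂ) (n : ℕ)
    (h₀ : (fibP (n + 1)).eval y - (fibP n).eval y = 0) :
    (fibP (n + 2)).eval y - (fibP (n + 1)).eval y ≠ 0 := by
  induction n with
  | zero => simp [fibP] at h₀
  | succ n ih =>
    intro h₁
    have r₀ := eval_fibP_add_two n y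
    have r₁ := eval_fibP_add_two (n + 1) y
    exact ih (by linear_combination y * h₀ - h₁ - r₀ + r₁) h₀

theorem eval_zero_fibP_succ_sub_sq (n : ℕ) :
    ((fibP (n + 1)).eval 0 - (fibP n).eval 0) ^ 2 = 1 := by
  induction n using Nat.twoStepInduction with
  | zero => simp [fibP]
  | one => simp [fibP]
  | more n ih _ =>
    rw [eval_fibP_add_two (n + 1), eval_fibP_add_two n]
    linear_combination ih

theorem eval_fibY (p : Fin 2 → ℂ) (m : ℕ) :
    MvPolynomial.eval p (fibY m) = (fibP m).eval (p 1) := by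
  rw [fibY, ← MvPolynomial.coe_aeval_eq_eval, RingHom.coe_coe, ← Polynomial.aeval_algHom_apply]
  simp

theorem pderiv_zero_fibY (m : ℕ) : MvPolynomial.pderiv 0 (fibY m) = 0 := by
  rw [fibY, Derivation.map_aeval, MvPolynomial.pderiv_X_of_ne (by decide), smul_zero]

/-- Lemma 5.9 (smoothness): for `k ≥ 1`, the affine plane curve `g_k = 0` has no
singular points: there is no point where `g_k` and both partial derivatives vanish. -/
theorem gPoly_no_singular_point (k : ℕ) (hk : 1 ≤ k) :
    ¬ ∃ p : Fin 2 → ℂ,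
      MvPolynomial.eval p (gPoly k) = 0 ∧
      MvPolynomial.eval p (MvPolynomial.pderiv 0 (gPoly k)) = 0 ∧
      MvPolynomial.eval p (MvPolynomial.pderiv 1 (gPoly k)) = 0 := by
  rintro ⟨p, hg, hx, -⟩
  have hh : (fibP (k + 1)).eval (p 1) - (fibP k).eval (p 1) = 0 := by
    simp [gPoly, pderiv_zero_fibY, eval_fibY] at hx
    linear_combination -hx
  have hy : p 1 * ((fibP (k + 2)).eval (p 1) - (fibP (k + 1)).eval (p 1)) = 0 := by
    simpa [gPoly, eval_fibY, hh] using hg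
  rcases mul_eq_zero.mp hy with h | h
  · have hsq := eval_zero_fibP_succ_sub_sq k
    rw [h] at hh
    simp [hh] at hsq
  · exact eval_fibP_sub_ne_zero_of_eval_fibP_sub_eq_zero (p 1) k hh h
end

section
/- Let f_n in C[u] be the Fibonacci polynomials, defined by f_0 = 0, f_1 = 1, and f_n = u*f_{n-1} - f_{n-2}. For every positive integer k, the polynomial h_k(x,z) = 2*z*(f_{k+2}(z) - f_{k+1}(z)) - x^2*(f_{k+1}(z) - f_k(z)) is irreducible in the polynomial ring C[x,z]. -/
/-- The Fibonacci polynomial `fₘ` with variable the second variable `z` of `ℂ[x,z]`. -/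
noncomputable def fibZ (m : ℕ) : MvPolynomial (Fin 2) ℂ :=
  Polynomial.aeval (MvPolynomial.X 1) (fibP m)

/-- The polynomial `h_k(x,z) = 2z(f_{k+2}(z) - f_{k+1}(z)) - x²(f_{k+1}(z) - f_k(z))`. -/
noncomputable def hPoly (k : ℕ) : MvPolynomial (Fin 2) ℂ :=
  2 * MvPolynomial.X 1 * (fibZ (k + 2) - fibZ (k + 1)) -
    (MvPolynomial.X 0) ^ 2 * (fibZ (k + 1) - fibZ k)

open Polynomial in
/-- A quadratic without linear term is irreducible as soon as its coefficients are coprime and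
a prime divides the constant one exactly once (Eisenstein). -/
theorem irreducible_C_mul_sub_X_sq_mul_C {R : Type*} [CommRing R] [IsDomain R] {z a b : R}
    (hz : Prime z) (hza : ¬ z ∣ a) (hab : IsCoprime (z * a) b) :
    Irreducible (C (z * a) - X ^ 2 * C b : R[X]) := by
  have hzb : ¬ z ∣ b := fun h =>
    hz.not_isUnit (hab.isUnit_of_dvd' (dvd_mul_right z a) h)
  have hb : b ≠ 0 := by rintro rfl; exact hzb (dvd_zero z)
  have hform : (C (z * a) - X ^ 2 * C b : R[X]) = C (-b) * X ^ 2 + C 0 * X + C (z * a) := by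
    simp only [C_neg, C_0]; ring
  rw [hform]
  have hdeg : (C (-b) * X ^ 2 + C 0 * X + C (z * a) : R[X]).natDegree = 2 :=
    natDegree_quadratic (neg_ne_zero.mpr hb)
  have h0 : (C (-b) * X ^ 2 + C 0 * X + C (z * a) : R[X]).coeff 0 = z * a := by simp
  have h1 : (C (-b) * X ^ 2 + C 0 * X + C (z * a) : R[X]).coeff 1 = 0 := by
    simp [coeff_X_pow]
  have h2 : (C (-b) * X ^ 2 + C 0 * X + C (z * a) : R[X]).coeff 2 = -b := by
    simp
  generalize (C (-b) * X ^ 2 + C 0 * X + C (z * a) : R[X]) = p at *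
  have hp0 : p ≠ 0 := by rintro rfl; simp at hdeg
  refine irreducible_of_eisenstein_criterion
    ((Ideal.span_singleton_prime hz.ne_zero).mpr hz) ?_ ?_ ?_ ?_ ?_
  · rw [leadingCoeff, hdeg, h2, Ideal.mem_span_singleton, dvd_neg]
    exact hzb
  · intro n hn
    rw [degree_eq_natDegree hp0, hdeg] at hn
    have hn : n < 2 := by exact_mod_cast hn
    rw [Ideal.mem_span_singleton]
    interval_cases n
    · rw [h0]; exact dvd_mul_right z a
    · rw [h1]; exact dvd_zero z
  · rw [degree_eq_natDegree hp0, hdeg]; norm_num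
  · rw [h0, Ideal.span_singleton_pow, Ideal.mem_span_singleton, pow_two]
    exact fun h => hza ((mul_dvd_mul_iff_left hz.ne_zero).mp h)
  · intro r hr
    rw [C_dvd_iff_dvd_coeff] at hr
    exact hab.isUnit_of_dvd' (h0 ▸ hr 0) ((dvd_neg).mp (h2 ▸ hr 2))

theorem fibP_succ_sub_recurrence (k : ℕ) :
    fibP (k + 3) - fibP (k + 2) =
      Polynomial.X * (fibP (k + 2) - fibP (k + 1)) - (fibP (k + 1) - fibP k) := by
  rw [fibP, fibP]; ring

theorem isCoprime_X_fibP_succ_sub (k : ℕ) :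
    IsCoprime (Polynomial.X : Polynomial ℂ) (fibP (k + 1) - fibP k) := by
  induction k using Nat.twoStepInduction with
  | zero => simp [fibP, isCoprime_one_right]
  | one => exact ⟨1, -1, by simp [fibP]⟩
  | more k ih _ =>
    rw [fibP_succ_sub_recurrence, sub_eq_neg_add]
    exact ih.neg_right.add_mul_left_right _

theorem isCoprime_fibP_succ_sub (k : ℕ) :
    IsCoprime (fibP (k + 2) - fibP (k + 1)) (fibP (k + 1) - fibP k) := by
  induction k with
  | zero => simp [fibP, isCoprime_one_right]
  | succ k ih =>
    rw [fibP_succ_sub_recurrence, sub_eq_neg_add]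
    exact ih.symm.neg_left.add_mul_right_left _

theorem finSuccEquiv_fibZ (m : ℕ) :
    MvPolynomial.finSuccEquiv ℂ 1 (fibZ m) =
      Polynomial.C (Polynomial.aeval (MvPolynomial.X 0) (fibP m)) := by
  have hX : MvPolynomial.finSuccEquiv ℂ 1 (MvPolynomial.X 1) =
      Polynomial.C (MvPolynomial.X 0) := MvPolynomial.finSuccEquiv_X_succ (j := 0)
  rw [fibZ, ← Polynomial.aeval_algHom_apply, hX]
  exact Polynomial.aeval_algHom_apply
    (Polynomial.CAlgHom : MvPolynomial (Fin 1) ℂ →ₐ[ℂ] _) (MvPolynomial.X 0) (fibP m)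

/-- Lemma 5.11: `h_k` is irreducible in `ℂ[x,z]` for every positive integer `k`. -/
theorem hPoly_irreducible (k : ℕ) (hk : 1 ≤ k) : Irreducible (hPoly k) := by
  rw [← MulEquiv.irreducible_iff (MvPolynomial.finSuccEquiv ℂ 1)]
  set φ : Polynomial ℂ →ₐ[ℂ] MvPolynomial (Fin 1) ℂ := Polynomial.aeval (MvPolynomial.X 0)
    with hφ
  have hX : MvPolynomial.finSuccEquiv ℂ 1 (MvPolynomial.X 1) =
      Polynomial.C (MvPolynomial.X 0) := MvPolynomial.finSuccEquiv_X_succ (j := 0)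
  have hφX : φ Polynomial.X = MvPolynomial.X 0 := Polynomial.aeval_X _
  have hz : Prime (MvPolynomial.X 0 : MvPolynomial (Fin 1) ℂ) := MvPolynomial.X_prime
  have h2 : IsUnit (2 : Polynomial ℂ) := by
    rw [← map_ofNat Polynomial.C 2, Polynomial.isUnit_C]
    exact isUnit_iff_ne_zero.mpr two_ne_zero
  have hza : IsCoprime (Polynomial.X : Polynomial ℂ) (2 * (fibP (k + 2) - fibP (k + 1))) :=
    (isCoprime_mul_unit_left_right h2 _ _).mpr (isCoprime_X_fibP_succ_sub (k + 1))
  have hab : IsCoprime (Polynomial.X * (2 * (fibP (k + 2) - fibP (k + 1))))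
      (fibP (k + 1) - fibP k) :=
    (isCoprime_X_fibP_succ_sub k).mul_left
      ((isCoprime_mul_unit_left_left h2 _ _).mpr (isCoprime_fibP_succ_sub k))
  have hza' := hza.map φ.toRingHom
  have hab' := hab.map φ.toRingHom
  simp only [AlgHom.toRingHom_eq_coe, RingHom.coe_coe, map_mul φ Polynomial.X, hφX] at hza' hab'
  convert irreducible_C_mul_sub_X_sq_mul_C hz
    (fun h => hz.not_isUnit (hza'.isUnit_of_dvd' dvd_rfl h)) hab' using 1
  simp only [hPoly, map_sub, map_mul, map_pow, map_ofNat, finSuccEquiv_fibZ, hX,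
    MvPolynomial.finSuccEquiv_X_zero, ← hφ]
  ring
end

section
/- Let f_n in C[u] be the Fibonacci polynomials, defined by f_0 = 0, f_1 = 1, and f_n = u*f_{n-1} - f_{n-2}. For every positive integer k, the polynomial r_k(x,y) = y^2*(f_{k+2}(x) - f_{k+1}(x)) - (x + y)*(f_{k+1}(x) - f_k(x)) is irreducible in the polynomial ring C[x,y]. -/
/-- The Fibonacci polynomial `fₘ` with variable the first variable `x` of `ℂ[x,y]`. -/
noncomputable def fibX (m : ℕ) : MvPolynomial (Fin 2) ℂ :=
  Polynomial.aeval (MvPolynomial.X 0) (fibP m)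

/-- The polynomial `r_k(x,y) = y²(f_{k+2}(x) - f_{k+1}(x)) - (x+y)(f_{k+1}(x) - f_k(x))`. -/
noncomputable def rPoly (k : ℕ) : MvPolynomial (Fin 2) ℂ :=
  (MvPolynomial.X 1) ^ 2 * (fibX (k + 2) - fibX (k + 1)) -
    (MvPolynomial.X 0 + MvPolynomial.X 1) * (fibX (k + 1) - fibX k)

open Polynomial

/-- The difference `fₙ₊₁ - fₙ` of consecutive Fibonacci polynomials. -/
noncomputable def fibDiff (n : ℕ) : ℂ[X] := fibP (n + 1) - fibP n

lemma fibDiff_zero : fibDiff 0 = 1 := by simp [fibDiff, fibP]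

lemma fibDiff_one : fibDiff 1 = X - 1 := by simp [fibDiff, fibP]

lemma fibDiff_add_two (n : ℕ) : fibDiff (n + 2) = X * fibDiff (n + 1) - fibDiff n := by
  simp only [fibDiff, fibP]
  ring

lemma monic_natDegree_fibDiff (n : ℕ) : (fibDiff n).Monic ∧ (fibDiff n).natDegree = n := by
  induction n using Nat.twoStepInduction with
  | zero => simp [fibDiff_zero]
  | one => exact ⟨by simpa [fibDiff_one] using monic_X_sub_C (1 : ℂ),
      by simpa [fibDiff_one] using natDegree_X_sub_C (1 : ℂ)⟩
  | more n ih₀ ih₁ =>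
    have hmonic : (X * fibDiff (n + 1)).Monic := monic_X.mul ih₁.1
    have hdeg : (X * fibDiff (n + 1)).natDegree = n + 2 := by
      rw [natDegree_X_mul ih₁.1.ne_zero, ih₁.2]
    have hlt : (fibDiff n).natDegree < (X * fibDiff (n + 1)).natDegree := by
      rw [ih₀.2, hdeg]
      omega
    rw [fibDiff_add_two]
    exact ⟨hmonic.sub_of_left (degree_lt_degree hlt),
      (natDegree_sub_eq_left_of_natDegree_lt hlt).trans hdeg⟩

lemma isCoprime_fibDiff_succ (n : ℕ) : IsCoprime (fibDiff n) (fibDiff (n + 1)) := by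
  induction n with
  | zero => simp [fibDiff_zero, isCoprime_one_left]
  | succ n ih =>
    obtain ⟨u, v, h⟩ := ih
    refine ⟨v + u * X, -u, ?_⟩
    rw [fibDiff_add_two]
    linear_combination h

lemma eval_zero_fibDiff_ne_zero (n : ℕ) : (fibDiff n).eval 0 ≠ 0 := by
  induction n using Nat.twoStepInduction with
  | zero => simp [fibDiff_zero]
  | one => simp [fibDiff_one]
  | more n ih₀ _ => simpa [fibDiff_add_two] using ih₀

lemma derivative_fibDiff (n : ℕ) :
    (X ^ 2 - 4) * derivative (fibDiff n) =
      (2 * (n : ℂ[X]) + 1) * fibDiff (n + 1) + (1 - ((n : ℂ[X]) + 1) * X) * fibDiff n := by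
  induction n using Nat.twoStepInduction with
  | zero => simp [fibDiff_zero, fibDiff_one]
  | one =>
    simp [fibDiff_add_two, fibDiff_zero, fibDiff_one]
    ring
  | more n ih₀ ih₁ =>
    rw [fibDiff_add_two (n + 1)]
    simp only [fibDiff_add_two n, derivative_sub, derivative_mul, derivative_X] at ih₁ ⊢
    push_cast at ih₁ ⊢
    linear_combination X * ih₁ - ih₀

lemma eval_fibDiff_succ_ne_zero {n : ℕ} {z : ℂ} (hz : (fibDiff n).eval z = 0) :
    (fibDiff (n + 1)).eval z ≠ 0 := by
  intro h
  obtain ⟨u, v, huv⟩ := isCoprime_fibDiff_succ n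
  simpa [hz, h] using congrArg (eval z) huv

lemma eval_derivative_fibDiff_ne_zero {n : ℕ} {z : ℂ} (hz : (fibDiff n).eval z = 0) :
    (derivative (fibDiff n)).eval z ≠ 0 := by
  intro h
  have key := congrArg (eval z) (derivative_fibDiff n)
  simp only [eval_mul, eval_add, h, hz, mul_zero, add_zero, eval_natCast, eval_ofNat,
    eval_one] at key
  rcases mul_eq_zero.mp key.symm with h' | h'
  · exact absurd h' (by exact_mod_cast Nat.succ_ne_zero (2 * n))
  · exact eval_fibDiff_succ_ne_zero hz h'

/-- A form of Eisenstein's criterion for quadratics over `ℂ[X]`. -/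
lemma irreducible_quadratic_of_simple_root {a b c : ℂ[X]} {z : ℂ} (hab : IsCoprime a b)
    (ha : a.eval z ≠ 0) (hb : b.eval z = 0) (hc : c.eval z = 0)
    (hc' : (derivative c).eval z ≠ 0) :
    Irreducible (C a * X ^ 2 + C b * X + C c) := by
  have ha0 : a ≠ 0 := by
    rintro rfl
    simp at ha
  have hmem (p : ℂ[X]) : p ∈ Ideal.span {X - C z} ↔ p.eval z = 0 := by
    rw [Ideal.mem_span_singleton, dvd_iff_isRoot, IsRoot]
  refine irreducible_of_eisenstein_criterion (P := Ideal.span {X - C z}) ?_ ?_ ?_ ?_ ?_ ?_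
  · rw [Ideal.span_singleton_prime (X_sub_C_ne_zero z)]
    exact prime_X_sub_C z
  · rwa [leadingCoeff_quadratic ha0, hmem]
  · intro n hn
    rw [degree_quadratic ha0] at hn
    have hn : n < 2 := by exact_mod_cast hn
    rw [hmem]
    interval_cases n <;> simpa [coeff_X, coeff_C]
  · rw [degree_quadratic ha0]
    norm_num
  · rw [Ideal.span_singleton_pow, Ideal.mem_span_singleton]
    rintro ⟨q, hq⟩
    have hq : c = (X - C z) ^ 2 * q := by simpa using hq
    apply hc'
    simp [hq, derivative_mul, derivative_pow]
  · intro r hr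
    rw [C_dvd_iff_dvd_coeff] at hr
    refine hab.isUnit_of_dvd' ?_ ?_
    · simpa [coeff_X, coeff_C] using hr 2
    · simpa [coeff_X, coeff_C] using hr 1

lemma rPoly_eq_equivMvPolynomial (k : ℕ) :
    rPoly k = Bivariate.equivMvPolynomial ℂ
      (C (fibDiff (k + 1)) * X ^ 2 + C (-fibDiff k) * X + C (-(X * fibDiff k))) := by
  have hC (p : ℂ[X]) :
      Bivariate.equivMvPolynomial ℂ (C p) = aeval (MvPolynomial.X 0) p := by
    simp [Bivariate.equivMvPolynomial, aeval_def, eval₂_eq_eval_map, MvPolynomial.algebraMap_eq]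
  simp only [map_add, map_mul, map_pow, hC, Bivariate.equivMvPolynomial_X, fibDiff, rPoly, fibX,
    map_neg, map_sub, aeval_X]
  ring

/-- Section 5.6.1: `r_k` is irreducible in `ℂ[x,y]` for every positive integer `k`. -/
theorem rPoly_irreducible (k : ℕ) (hk : 1 ≤ k) : Irreducible (rPoly k) := by
  obtain ⟨z, hz⟩ : ∃ z, IsRoot (fibDiff k) z := by
    refine Complex.exists_root (natDegree_pos_iff_degree_pos.mp ?_)
    rwa [(monic_natDegree_fibDiff k).2]
  rw [rPoly_eq_equivMvPolynomial, MulEquiv.irreducible_iff]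
  have hz0 : z ≠ 0 := by
    rintro rfl
    exact eval_zero_fibDiff_ne_zero k hz
  have hz : (fibDiff k).eval z = 0 := hz
  refine irreducible_quadratic_of_simple_root (z := z) (isCoprime_fibDiff_succ k).symm.neg_right
    (eval_fibDiff_succ_ne_zero hz) (by simp [hz]) (by simp [hz]) ?_
  simpa [hz] using ⟨hz0, eval_derivative_fibDiff_ne_zero hz⟩
end

section
/- Let n be a nonzero even integer, and let x be a complex number with x ≠ 0, x^2 ≠ 1 and x^n ≠ 1, and let y be a complex number satisfying x^2 + x^n = y^2 * x^n * (1 - x^2) * (1 - x^n). Define the 2x2 complex matrices A = [[-y*x^n, -1], [(1 + x^{n+2})/((1 - x^2)*(1 - x^n)), y]] and B = [[x, 0], [0, x^{-1}]]. Then det(A) = 1 and A * B^{-n} * A + B * A * A * B = 0 (the zero matrix), where B^{-n} denotes the integer power of B. -/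
/-- Integer powers of an invertible diagonal `2 × 2` matrix are computed entrywise. -/
theorem Matrix.diag_fin_two_zpow {K : Type*} [Field K] {a b : K} (ha : a ≠ 0) (hb : b ≠ 0)
    (n : ℤ) : (!![a, 0; 0, b] : Matrix (Fin 2) (Fin 2) K) ^ n = !![a ^ n, 0; 0, b ^ n] := by
  have hdet : IsUnit (!![a, 0; 0, b] : Matrix (Fin 2) (Fin 2) K).det := by
    simp [Matrix.det_fin_two_of, ha, hb]
  have hinv : (!![a, 0; 0, b] : Matrix (Fin 2) (Fin 2) K)⁻¹ = !![a⁻¹, 0; 0, b⁻¹] :=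
    Matrix.inv_eq_right_inv (by simp [Matrix.one_fin_two, ha, hb])
  induction n with
  | zero => simp [Matrix.one_fin_two]
  | succ k ih => simp [Matrix.zpow_add_one hdet, ih, zpow_add_one₀ ha, zpow_add_one₀ hb]
  | pred k ih =>
    rw [Matrix.zpow_sub_one hdet, ih, hinv, zpow_sub_one₀ ha, zpow_sub_one₀ hb]
    simp

/-- Example 2.3: for even `n ≠ 0` and suitable `x, y`, the matrices
`A = [[-y xⁿ, -1],[(1+x^{n+2})/((1-x²)(1-xⁿ)), y]]` and `B = diag(x, x⁻¹)`
satisfy `det A = 1` and `A B⁻ⁿ A = - B A² B`, so the corresponding `PSL(2,ℂ)`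
representation does not lift to `SL(2,ℂ)`. -/
theorem nonlifting_representation (n : ℤ) (hn : n ≠ 0) (hne : Even n)
    (x : ℂ) (hx : x ≠ 0) (hx2 : x ^ 2 ≠ 1) (hxn : x ^ n ≠ 1)
    (y : ℂ) (hy : x ^ 2 + x ^ n = y ^ 2 * x ^ n * (1 - x ^ 2) * (1 - x ^ n)) :
    (!![-y * x ^ n, -1;
        (1 + x ^ (n + 2)) / ((1 - x ^ 2) * (1 - x ^ n)), y] :
          Matrix (Fin 2) (Fin 2) ℂ).det = 1 ∧
    (!![-y * x ^ n, -1;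
        (1 + x ^ (n + 2)) / ((1 - x ^ 2) * (1 - x ^ n)), y] :
          Matrix (Fin 2) (Fin 2) ℂ) *
        (!![x, 0; 0, x⁻¹] : Matrix (Fin 2) (Fin 2) ℂ) ^ (-n) *
        !![-y * x ^ n, -1;
            (1 + x ^ (n + 2)) / ((1 - x ^ 2) * (1 - x ^ n)), y] +
      (!![x, 0; 0, x⁻¹] : Matrix (Fin 2) (Fin 2) ℂ) *
        !![-y * x ^ n, -1;
            (1 + x ^ (n + 2)) / ((1 - x ^ 2) * (1 - x ^ n)), y] *
        !![-y * x ^ n, -1;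
            (1 + x ^ (n + 2)) / ((1 - x ^ 2) * (1 - x ^ n)), y] *
        !![x, 0; 0, x⁻¹] = 0 := by
  have ht : x ^ n ≠ 0 := zpow_ne_zero n hx
  rw [Matrix.diag_fin_two_zpow hx (inv_ne_zero hx), inv_zpow', neg_neg, zpow_neg,
    zpow_add₀ hx, zpow_ofNat]
  generalize x ^ n = t at *
  have hk : (1 - x ^ 2) * (1 - t) ≠ 0 :=
    mul_ne_zero (sub_ne_zero.mpr hx2.symm) (sub_ne_zero.mpr hxn.symm)
  obtain ⟨c, hc⟩ : ∃ c, c = (1 + t * x ^ 2) / ((1 - x ^ 2) * (1 - t)) := ⟨_, rfl⟩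
  rw [← hc]
  rw [eq_div_iff hk] at hc
  have hrel : y ^ 2 * t * (1 + t * x ^ 2) = c * (t + x ^ 2) := by
    apply mul_right_cancel₀ hk
    linear_combination (-(1 + t * x ^ 2)) * hy - (t + x ^ 2) * hc
  constructor
  · rw [Matrix.det_fin_two_of]
    apply mul_right_cancel₀ hk
    linear_combination hy + hc
  · ext i j
    fin_cases i <;> fin_cases j <;> simp <;> field_simp
    · linear_combination hrel
    · ring
    · ring
    · linear_combination hrel
end
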